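/- Exponential parameter learning for the Heavy Ball tuner: under the hypotheses of Theorem 1 (0 < β < 2, 0 < γ ≤ β(2−β)/8, PE with level ε over window ΔT, ‖φ_k‖ ≤ Φ for all k, 0 < λ < 1, η > 0 with γη|1−β| < ε₁ = ε/√(1+Φ²)), with μ = min{(11/8)λγη²/ΔT, (21/32)ΔT(ε₁ − γη|1−β|)²λγ/(1+γΔT)², (11/8)(1−λ)γ/ΔT}, the parameter error satisfies ‖θ_k − θ*‖² ≤ 2γ·exp(−μ·⌊k/ΔT⌋)·V_0 for every k ≥ 0; in particular θ_k → θ* exponentially fast. -/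

import Mathlib

open scoped RealInnerProductSpace

section HeavyBallTuner

variable {E : Type*} [NormedAddCommGroup E] [InnerProductSpace ℝ E]

/-- One-step decrease of the Heavy Ball Lyapunov function, in the error coordinates
`e = ϑ - θ*` and `d = θ - ϑ`, with `b = 1 - β`. -/
lemma heavyBall_step_decrease (e d φ : E) {b γ : ℝ} (hγ0 : 0 < γ) (hγ : 8 * γ ≤ 1 - b ^ 2) :
    ‖e - (γ / (1 + ‖φ‖ ^ 2) * ⟪φ, e + b • d⟫) • φ‖ ^ 2 +
        ‖b • d + (γ / (1 + ‖φ‖ ^ 2) * ⟪φ, e + b • d⟫) • φ‖ ^ 2 ≤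
      ‖e‖ ^ 2 + ‖d‖ ^ 2 -
        11 / 8 * γ * ((⟪φ, e + b • d⟫ / √(1 + ‖φ‖ ^ 2)) ^ 2 + ‖d‖ ^ 2) := by
  have hN : 0 < 1 + ‖φ‖ ^ 2 := by positivity
  rw [norm_sub_sq_real, norm_add_sq_real, div_pow, Real.sq_sqrt hN.le]
  simp only [norm_smul, mul_pow, Real.norm_eq_abs, sq_abs, inner_smul_left, inner_smul_right,
    inner_add_right, RCLike.conj_to_real]
  rw [real_inner_comm φ e, real_inner_comm φ d]
  have hcs : ⟪φ, d⟫ ^ 2 ≤ ‖φ‖ ^ 2 * ‖d‖ ^ 2 := by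
    rw [← mul_pow, ← sq_abs]
    gcongr
    exact abs_real_inner_le_norm φ d
  generalize ⟪φ, d⟫ = p at hcs ⊢
  obtain ⟨u, hu⟩ : ∃ u, ⟪φ, e⟫ + b * p = (1 + ‖φ‖ ^ 2) * u :=
    ⟨(⟪φ, e⟫ + b * p) / (1 + ‖φ‖ ^ 2), by field_simp⟩
  obtain ⟨r, rfl⟩ : ∃ r, p = (1 + ‖φ‖ ^ 2) * r := ⟨p / (1 + ‖φ‖ ^ 2), by field_simp⟩
  have hq : ⟪φ, e⟫ = (1 + ‖φ‖ ^ 2) * u - b * ((1 + ‖φ‖ ^ 2) * r) := by linarith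
  rw [hu, hq]
  have h1 : γ / (1 + ‖φ‖ ^ 2) * ((1 + ‖φ‖ ^ 2) * u) = γ * u := by field_simp
  have h2 : ((1 + ‖φ‖ ^ 2) * u) ^ 2 / (1 + ‖φ‖ ^ 2) = (1 + ‖φ‖ ^ 2) * u ^ 2 := by field_simp
  have h3 : (γ / (1 + ‖φ‖ ^ 2)) ^ 2 * ((1 + ‖φ‖ ^ 2) * u) ^ 2 = γ ^ 2 * u ^ 2 := by field_simp
  rw [h1, h2, h3]
  generalize ‖φ‖ ^ 2 = F at *
  have hD0 : 0 ≤ ‖d‖ ^ 2 := by positivity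
  generalize ‖d‖ ^ 2 = D at *
  have hr : (1 + F) * r ^ 2 ≤ D := by
    refine le_of_mul_le_mul_left ?_ hN
    nlinarith
  have hyoung : 4 * b * u * ((1 + F) * r) ≤
      (1 + F) * (5 / 8 * (1 - 8 * γ) * u ^ 2) + 32 / 5 * D := by
    nlinarith [mul_nonneg hN.le (sq_nonneg (b * u - 16 / 5 * r)),
      mul_nonneg (mul_nonneg hN.le (sq_nonneg u)) (sub_nonneg.2 hγ)]
  have hu2 : 0 ≤ γ * (1 + F) * u ^ 2 := by positivity
  have hγu : 0 ≤ γ * u ^ 2 := by positivity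
  have hkey : 4 * b * u * ((1 + F) * r) + 2 * γ * u ^ 2 * F + 11 / 8 * D ≤
      5 / 8 * ((1 + F) * u ^ 2) + 8 * D := by
    nlinarith
  nlinarith [mul_le_mul_of_nonneg_left hkey hγ0.le, mul_le_mul_of_nonneg_right hγ hD0]

/-- A normalized inner product is bounded by the norm of the other argument. -/
lemma abs_inner_div_sqrt_one_add_le (φ v : E) : |⟪φ, v⟫| / √(1 + ‖φ‖ ^ 2) ≤ ‖v‖ := by
  have hN : 0 < √(1 + ‖φ‖ ^ 2) := by positivity
  rw [div_le_iff₀ hN, mul_comm]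
  refine (abs_real_inner_le_norm φ v).trans ?_
  gcongr
  exact Real.le_sqrt_of_sq_le (by linarith)

/-- A normalized gradient step moves the estimate by at most `γ` times the normalized
prediction error. -/
lemma norm_normalized_step_le (φ : E) {γ : ℝ} (hγ0 : 0 < γ) (s : ℝ) :
    ‖(γ / (1 + ‖φ‖ ^ 2) * s) • φ‖ ≤ γ * |s / √(1 + ‖φ‖ ^ 2)| := by
  have hN : 0 < √(1 + ‖φ‖ ^ 2) := by positivity
  have hsq : √(1 + ‖φ‖ ^ 2) * √(1 + ‖φ‖ ^ 2) = 1 + ‖φ‖ ^ 2 :=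
    Real.mul_self_sqrt (by positivity)
  have hle : ‖φ‖ ≤ √(1 + ‖φ‖ ^ 2) := Real.le_sqrt_of_sq_le (by linarith)
  rw [norm_smul, Real.norm_eq_abs, abs_mul, abs_div, abs_div, abs_of_pos hγ0,
    abs_of_pos hN, abs_of_pos (by positivity : 0 < 1 + ‖φ‖ ^ 2)]
  generalize √(1 + ‖φ‖ ^ 2) = r at *
  rw [← hsq]
  calc γ / (r * r) * |s| * ‖φ‖ ≤ γ / (r * r) * |s| * r := by gcongr
    _ = γ * (|s| / r) := by field_simp

/-- Over a window, the excitation seen by the initial error is controlled by the normalized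
prediction errors and the momentum terms. -/
lemma heavyBall_window_excitation (e d φ : ℕ → E) {b γ c : ℝ} (hγ0 : 0 < γ) (T : ℕ)
    (he : ∀ i, e (i + 1) =
      e i - (γ / (1 + ‖φ i‖ ^ 2) * ⟪φ i, e i + b • d i⟫) • φ i)
    (hc : c ≤ ∑ i ∈ Finset.range T, |⟪φ i, e 0⟫| / √(1 + ‖φ i‖ ^ 2)) :
    c ≤ ∑ i ∈ Finset.range T,
      ((1 + γ * T) * |⟪φ i, e i + b • d i⟫ / √(1 + ‖φ i‖ ^ 2)| + |b| * ‖d i‖) := by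
  set x : ℕ → ℝ := fun i => |⟪φ i, e i + b • d i⟫ / √(1 + ‖φ i‖ ^ 2)| with hx
  have hdrift : ∀ i, ‖e i - e 0‖ ≤ γ * ∑ j ∈ Finset.range i, x j := by
    intro i
    induction i with
    | zero => simp
    | succ i ih =>
      have hsplit : e (i + 1) - e 0 = (e i - e 0) -
          (γ / (1 + ‖φ i‖ ^ 2) * ⟪φ i, e i + b • d i⟫) • φ i := by
        rw [he]; abel
      rw [hsplit, Finset.sum_range_succ, mul_add]
      exact (norm_sub_le _ _).trans
        (add_le_add ih (norm_normalized_step_le (φ i) hγ0 _))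
  have hterm : ∀ i ∈ Finset.range T, |⟪φ i, e 0⟫| / √(1 + ‖φ i‖ ^ 2) ≤
      x i + |b| * ‖d i‖ + γ * ∑ j ∈ Finset.range T, x j := by
    intro i hi
    have hN : 0 < √(1 + ‖φ i‖ ^ 2) := by positivity
    have hsplit : ⟪φ i, e 0⟫ =
        ⟪φ i, e i + b • d i⟫ - b * ⟪φ i, d i⟫ - ⟪φ i, e i - e 0⟫ := by
      simp only [inner_add_right, inner_sub_right, inner_smul_right]; ring
    have htri : |⟪φ i, e 0⟫| ≤
        |⟪φ i, e i + b • d i⟫| + |b| * |⟪φ i, d i⟫| + |⟪φ i, e i - e 0⟫| := by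
      rw [hsplit, ← abs_mul]
      exact (abs_sub _ _).trans (by gcongr; exact abs_sub _ _)
    have hmono : ∑ j ∈ Finset.range i, x j ≤ ∑ j ∈ Finset.range T, x j :=
      Finset.sum_le_sum_of_subset_of_nonneg
        (Finset.range_mono (Finset.mem_range.1 hi).le) (fun _ _ _ => abs_nonneg _)
    calc |⟪φ i, e 0⟫| / √(1 + ‖φ i‖ ^ 2)
        ≤ (|⟪φ i, e i + b • d i⟫| + |b| * |⟪φ i, d i⟫| + |⟪φ i, e i - e 0⟫|) /
            √(1 + ‖φ i‖ ^ 2) := by gcongr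
      _ = x i + |b| * (|⟪φ i, d i⟫| / √(1 + ‖φ i‖ ^ 2)) +
            |⟪φ i, e i - e 0⟫| / √(1 + ‖φ i‖ ^ 2) := by
          rw [hx]; simp only [abs_div, abs_of_pos hN]; ring
      _ ≤ x i + |b| * ‖d i‖ + ‖e i - e 0‖ := by
          gcongr <;> exact abs_inner_div_sqrt_one_add_le _ _
      _ ≤ x i + |b| * ‖d i‖ + γ * ∑ j ∈ Finset.range T, x j := by
          gcongr
          exact (hdrift i).trans (by gcongr)
  refine hc.trans ((Finset.sum_le_sum hterm).trans (le_of_eq ?_))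
  simp only [Finset.sum_add_distrib, Finset.sum_const, Finset.card_range, nsmul_eq_mul,
    ← Finset.mul_sum]
  ring

/-- Quadratic form of `heavyBall_window_excitation`. -/
lemma heavyBall_window_sum_sq (e d φ : ℕ → E) {b γ c : ℝ} (hγ0 : 0 < γ) (hb : b ^ 2 ≤ 1)
    (T : ℕ) (hc0 : 0 ≤ c)
    (he : ∀ i, e (i + 1) =
      e i - (γ / (1 + ‖φ i‖ ^ 2) * ⟪φ i, e i + b • d i⟫) • φ i)
    (hc : T * c ≤ ∑ i ∈ Finset.range T, |⟪φ i, e 0⟫| / √(1 + ‖φ i‖ ^ 2)) :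
    T * c ^ 2 ≤ 2 * (1 + γ * T) ^ 2 * ∑ i ∈ Finset.range T,
      ((⟪φ i, e i + b • d i⟫ / √(1 + ‖φ i‖ ^ 2)) ^ 2 + ‖d i‖ ^ 2) := by
  rcases T.eq_zero_or_pos with rfl | hT
  · simp
  have hT' : (0 : ℝ) < T := by exact_mod_cast hT
  have hexc := heavyBall_window_excitation e d φ hγ0 T he hc
  have hsq := (pow_le_pow_left₀ (by positivity) hexc 2).trans sq_sum_le_card_mul_sum_sq
  rw [Finset.card_range] at hsq
  have hterm : ∀ i ∈ Finset.range T,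
      ((1 + γ * T) * |⟪φ i, e i + b • d i⟫ / √(1 + ‖φ i‖ ^ 2)| + |b| * ‖d i‖) ^ 2 ≤
      2 * (1 + γ * T) ^ 2 *
        ((⟪φ i, e i + b • d i⟫ / √(1 + ‖φ i‖ ^ 2)) ^ 2 + ‖d i‖ ^ 2) := by
    intro i _
    refine add_sq_le.trans ?_
    have hg : b ^ 2 ≤ (1 + γ * T) ^ 2 := by nlinarith [mul_pos hγ0 hT']
    rw [mul_pow, mul_pow, sq_abs, sq_abs, mul_assoc, mul_add ((1 + γ * T) ^ 2)]
    gcongr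
  refine le_of_mul_le_mul_left ?_ hT'
  calc (T : ℝ) * (T * c ^ 2) = (T * c) ^ 2 := by ring
    _ ≤ _ := hsq
    _ ≤ _ := by
      rw [Finset.mul_sum (Finset.range T) _ (2 * (1 + γ * T) ^ 2)]
      gcongr with i hi
      exact hterm i hi

/-- Persistent excitation by bounded regressors, restated for an arbitrary vector
and normalized regressors. -/
lemma excitation_normalized_sum_le (φ : ℕ → E) {T : ℕ} (hT : 1 ≤ T) {ε Φ : ℝ}
    (hPE : ∀ m, T ≤ m → ∀ w : E, ‖w‖ = 1 →
      ε ≤ (1 / (T : ℝ)) * ∑ i ∈ Finset.Ico (m - T) m, |⟪φ i, w⟫|)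
    (hΦ : ∀ m, ‖φ m‖ ≤ Φ) (k : ℕ) (v : E) :
    (T : ℝ) * (ε / √(1 + Φ ^ 2) * ‖v‖) ≤
      ∑ i ∈ Finset.range T, |⟪φ (k + i), v⟫| / √(1 + ‖φ (k + i)‖ ^ 2) := by
  have hT0 : (0 : ℝ) < T := by exact_mod_cast hT
  have hS : 0 < √(1 + Φ ^ 2) := by positivity
  have hexc : (T : ℝ) * ε * ‖v‖ ≤
      ∑ i ∈ Finset.range T, |⟪φ (k + i), v⟫| := by
    by_cases h0 : v = 0
    · simp [h0]
    have hn0 : 0 < ‖v‖ := norm_pos_iff.2 h0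
    have h := hPE (k + T) (Nat.le_add_left _ _) (‖v‖⁻¹ • v)
      (norm_smul_inv_norm h0)
    rw [Finset.sum_Ico_eq_sum_range, Nat.add_sub_cancel, Nat.add_sub_cancel_left] at h
    simp only [inner_smul_right, abs_mul, abs_inv, abs_norm, ← Finset.mul_sum] at h
    calc (T : ℝ) * ε * ‖v‖ ≤ T * (1 / T * (‖v‖⁻¹ *
          ∑ i ∈ Finset.range T, |⟪φ (k + i), v⟫|)) * ‖v‖ := by gcongr
      _ = _ := by field_simp
  calc (T : ℝ) * (ε / √(1 + Φ ^ 2) * ‖v‖)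
      = (T * ε * ‖v‖) / √(1 + Φ ^ 2) := by ring
    _ ≤ (∑ i ∈ Finset.range T, |⟪φ (k + i), v⟫|) / √(1 + Φ ^ 2) := by gcongr
    _ = ∑ i ∈ Finset.range T, |⟪φ (k + i), v⟫| / √(1 + Φ ^ 2) :=
        Finset.sum_div _ _ _
    _ ≤ _ := by
        gcongr with i
        exact hΦ _

end HeavyBallTuner

/-- An antitone sequence contracting by `exp (-μ)` over every block of length `T` decays
exponentially in the number of completed blocks. -/
lemma Antitone.le_exp_mul_of_block_contraction {V : ℕ → ℝ} (hV : Antitone V) {μ : ℝ} {T : ℕ}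
    (h : ∀ k, V (k + T) ≤ Real.exp (-μ) * V k) (k : ℕ) :
    V k ≤ Real.exp (-μ * ((k / T : ℕ) : ℝ)) * V 0 := by
  have hblocks : ∀ m : ℕ, V (m * T) ≤ Real.exp (-μ * m) * V 0 := by
    intro m
    induction m with
    | zero => simp
    | succ m ih =>
      rw [Nat.succ_mul]
      calc V (m * T + T) ≤ Real.exp (-μ) * V (m * T) := h _
        _ ≤ Real.exp (-μ) * (Real.exp (-μ * m) * V 0) := by gcongr
        _ = Real.exp (-μ * (m + 1 : ℕ)) * V 0 := by
          rw [← mul_assoc, ← Real.exp_add]; push_cast; ring_nf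
  exact (hV (Nat.div_mul_le_self k T)).trans (hblocks _)

/-- The decrease available over an excited window dominates the corresponding rate. -/
lemma excited_decrease_bound {T l γ g ε₁ v x S : ℝ} (hT : 0 ≤ T) (hl : 0 ≤ l) (hγ : 0 ≤ γ)
    (hg : 0 ≤ g) (hgε : g ≤ ε₁) (hv : 0 ≤ v) (hx : l * (γ * v) ≤ x ^ 2)
    (hS : T * (ε₁ * x) ^ 2 ≤ 2 * (1 + γ * T) ^ 2 * S) :
    21 / 32 * T * (ε₁ - g) ^ 2 * l * γ / (1 + γ * T) ^ 2 * v ≤ 11 / 8 * S := by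
  have hG : 0 < (1 + γ * T) ^ 2 := by positivity
  have hε : (ε₁ - g) ^ 2 ≤ ε₁ ^ 2 := by
    gcongr
    linarith
  have hmul := mul_le_mul_of_nonneg_left
    (mul_le_mul hε hx (by positivity) (sq_nonneg ε₁)) hT
  have h0 : 0 ≤ T * (ε₁ ^ 2 * x ^ 2) := by positivity
  rw [div_mul_eq_mul_div, div_le_iff₀ hG]
  linarith

theorem hb_parameter_learning
    (n : ℕ) (hn : 1 ≤ n)
    (θstar : EuclideanSpace ℝ (Fin n))
    (φ θ ϑ : ℕ → EuclideanSpace ℝ (Fin n))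
    (β γ : ℝ) (hβ0 : 0 < β) (hβ2 : β < 2)
    (hγ0 : 0 < γ) (hγ : γ ≤ β * (2 - β) / 8)
    (hθ : ∀ k, θ (k + 1) = θ k - β • (θ k - ϑ k))
    (hϑ : ∀ k, ϑ (k + 1) =
      ϑ k - ((γ / (1 + ‖φ k‖ ^ 2)) * ⟪φ k, θ (k + 1) - θstar⟫) • φ k)
    (V : ℕ → ℝ)
    (hV : ∀ k, V k = (1 / γ) * ‖ϑ k - θstar‖ ^ 2 + (1 / γ) * ‖θ k - ϑ k‖ ^ 2)
    (ΔT : ℕ) (hΔT : 1 ≤ ΔT)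
    (ε : ℝ) (hε : 0 < ε)
    (hPE : ∀ m, ΔT ≤ m → ∀ w : EuclideanSpace ℝ (Fin n), ‖w‖ = 1 →
      ε ≤ (1 / (ΔT : ℝ)) * ∑ i ∈ Finset.Ico (m - ΔT) m, |⟪φ i, w⟫|)
    (Φ : ℝ) (hΦ : ∀ m, ‖φ m‖ ≤ Φ)
    (lam η : ℝ) (hlam0 : 0 < lam) (hlam1 : lam < 1) (hη : 0 < η)
    (hηε : γ * η * |1 - β| < ε / Real.sqrt (1 + Φ ^ 2))
    (μ : ℝ)
    (hμ : μ = min (min ((11 / 8) * lam * γ * η ^ 2 / (ΔT : ℝ))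
      ((21 / 32) * (ΔT : ℝ) * (ε / Real.sqrt (1 + Φ ^ 2) - γ * η * |1 - β|) ^ 2 *
        lam * γ / (1 + γ * ΔT) ^ 2))
      ((11 / 8) * (1 - lam) * γ / (ΔT : ℝ)))
    :
    ∀ k : ℕ, ‖θ k - θstar‖ ^ 2 ≤ 2 * γ * Real.exp (-μ * ((k / ΔT : ℕ) : ℝ)) * V 0 := by
  have hT' : (1 : ℝ) ≤ ΔT := by exact_mod_cast hΔT
  have hT0 : (0 : ℝ) < ΔT := by linarith
  have hb : 8 * γ ≤ 1 - (1 - β) ^ 2 := by nlinarith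
  have hpred : ∀ k, θ (k + 1) - θstar = (ϑ k - θstar) + (1 - β) • (θ k - ϑ k) := by
    intro k; rw [hθ]; module
  have he : ∀ k, ϑ (k + 1) - θstar = (ϑ k - θstar) - (γ / (1 + ‖φ k‖ ^ 2) *
      ⟪φ k, (ϑ k - θstar) + (1 - β) • (θ k - ϑ k)⟫) • φ k := by
    intro k; rw [← hpred, hϑ]; abel
  have hd : ∀ k, θ (k + 1) - ϑ (k + 1) = (1 - β) • (θ k - ϑ k) + (γ / (1 + ‖φ k‖ ^ 2) *
      ⟪φ k, (ϑ k - θstar) + (1 - β) • (θ k - ϑ k)⟫) • φ k := by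
    intro k; rw [← hpred, hϑ, hθ]; module
  have hγV : ∀ k, γ * V k = ‖ϑ k - θstar‖ ^ 2 + ‖θ k - ϑ k‖ ^ 2 := by
    intro k; rw [hV]; field_simp
  have hV0 : ∀ k, 0 ≤ V k := by
    intro k; rw [hV]; positivity
  set R : ℕ → ℝ := fun k =>
    (⟪φ k, (ϑ k - θstar) + (1 - β) • (θ k - ϑ k)⟫ / √(1 + ‖φ k‖ ^ 2)) ^ 2 + ‖θ k - ϑ k‖ ^ 2
    with hR
  have hR0 : ∀ k, 0 ≤ R k := fun k => by positivity
  have hstep : ∀ k, V (k + 1) ≤ V k - 11 / 8 * R k := by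
    intro k
    have h := heavyBall_step_decrease (ϑ k - θstar) (θ k - ϑ k) (φ k) hγ0 hb
    rw [← he, ← hd, ← hγV, ← hγV] at h
    refine le_of_mul_le_mul_left ?_ hγ0
    linarith
  have hanti : Antitone V := antitone_nat_of_succ_le fun k => by linarith [hstep k, hR0 k]
  have hsum : ∀ k T, V (k + T) ≤ V k - 11 / 8 * ∑ i ∈ Finset.range T, R (k + i) := by
    intro k T
    induction T with
    | zero => simp
    | succ T ih =>
      rw [Finset.sum_range_succ, ← Nat.add_assoc]
      linarith [hstep (k + T)]
  have hPE' : ∀ k, (ΔT : ℝ) * (ε / √(1 + Φ ^ 2) * ‖ϑ k - θstar‖) ≤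
      ∑ i ∈ Finset.range ΔT, |⟪φ (k + i), ϑ k - θstar⟫| / √(1 + ‖φ (k + i)‖ ^ 2) :=
    fun k => excitation_normalized_sum_le φ hΔT hPE hΦ k _
  have hwindow : ∀ k, V (k + ΔT) ≤ Real.exp (-μ) * V k := by
    intro k
    suffices h : μ * V k ≤ 11 / 8 * ∑ i ∈ Finset.range ΔT, R (k + i) by
      nlinarith [hsum k ΔT, Real.add_one_le_exp (-μ), hV0 k]
    have hlam : lam * (γ * V k) ≤ ‖ϑ k - θstar‖ ^ 2 ∨
        (1 - lam) * (γ * V k) ≤ ‖θ k - ϑ k‖ ^ 2 := by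
      by_contra! hcon
      linarith [hγV k]
    rcases hlam with h | h
    · have hq := heavyBall_window_sum_sq (fun i => ϑ (k + i) - θstar)
        (fun i => θ (k + i) - ϑ (k + i)) (fun i => φ (k + i)) hγ0
        (by linarith : (1 - β) ^ 2 ≤ 1) ΔT (by positivity) (fun i => he (k + i)) (hPE' k)
      change _ ≤ 2 * (1 + γ * ΔT) ^ 2 * ∑ i ∈ Finset.range ΔT, R (k + i) at hq
      have hμ2 := hμ.le.trans ((min_le_left _ _).trans (min_le_right _ _))
      exact (mul_le_mul_of_nonneg_right hμ2 (hV0 k)).trans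
        (excited_decrease_bound hT0.le hlam0.le hγ0.le (by positivity) hηε.le (hV0 k) h hq)
    · have hμ3 : μ ≤ 11 / 8 * (1 - lam) * γ / ΔT := hμ.le.trans (min_le_right _ _)
      have hl : 0 ≤ 11 / 8 * (1 - lam) * γ :=
        mul_nonneg (mul_nonneg (by norm_num) (by linarith)) hγ0.le
      have hfirst : R (k + 0) ≤ ∑ i ∈ Finset.range ΔT, R (k + i) :=
        Finset.single_le_sum (f := fun i => R (k + i)) (fun i _ => hR0 _)
          (Finset.mem_range.2 hΔT)
      rw [Nat.add_zero] at hfirst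
      have hdR : ‖θ k - ϑ k‖ ^ 2 ≤ R k := le_add_of_nonneg_left (sq_nonneg _)
      have := mul_le_mul_of_nonneg_right (hμ3.trans (div_le_self hl hT')) (hV0 k)
      linarith
  intro k
  have hsplit : θ k - θstar = (ϑ k - θstar) + (θ k - ϑ k) := by abel
  calc ‖θ k - θstar‖ ^ 2 ≤ (‖ϑ k - θstar‖ + ‖θ k - ϑ k‖) ^ 2 := by
        rw [hsplit]; gcongr; exact norm_add_le _ _
    _ ≤ 2 * (‖ϑ k - θstar‖ ^ 2 + ‖θ k - ϑ k‖ ^ 2) := add_sq_le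
    _ = 2 * γ * V k := by rw [← hγV]; ring
    _ ≤ 2 * γ * (Real.exp (-μ * ((k / ΔT : ℕ) : ℝ)) * V 0) := by
        gcongr; exact hanti.le_exp_mul_of_block_contraction hwindow k
    _ = 2 * γ * Real.exp (-μ * ((k / ΔT : ℕ) : ℝ)) * V 0 := by ring
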